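/- arXiv:1111.1749 — 4 statements merged into one kernel-verified Lean document; each statement's English description precedes it below -/
import Mathlib

section
/- Let data be as in the context (deformation retraction with side conditions and a small perturbation). Then p' ∘ i' = id on C₂. -/
theorem perturbed_projection_inclusion_eq_id
    {R : Type*} [CommRing R]
    {C₁ C₂ : Type*} [AddCommGroup C₁] [Module R C₁] [AddCommGroup C₂] [Module R C₂]
    (d₁ h δ : Module.End R C₁) (d₂ : Module.End R C₂)
    (i : C₂ →ₗ[R] C₁) (p : C₁ →ₗ[R] C₂)
    (hd₁ : d₁ * d₁ = 0) (hd₂ : d₂ * d₂ = 0)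
    (hchain_i : d₁ ∘ₗ i = i ∘ₗ d₂) (hchain_p : p ∘ₗ d₁ = d₂ ∘ₗ p)
    (hpi : p ∘ₗ i = LinearMap.id)
    (hhtpy : (1 : Module.End R C₁) - i ∘ₗ p = d₁ * h + h * d₁)
    (hside₁ : h ∘ₗ i = 0) (hside₂ : p ∘ₗ h = 0) (hside₃ : h * h = 0)
    (hpert : (d₁ + δ) * (d₁ + δ) = 0)
    (N : ℕ) (hnil : (δ * h) ^ N = 0)
    (A : Module.End R C₁) (hA : A = ∑ n ∈ Finset.range N, (δ * h) ^ n * δ)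
    (d₂' : Module.End R C₂) (hd₂' : d₂' = d₂ + p ∘ₗ (A ∘ₗ i))
    (i' : C₂ →ₗ[R] C₁) (hi' : i' = i + h ∘ₗ (A ∘ₗ i))
    (p' : C₁ →ₗ[R] C₂) (hp' : p' = p + p ∘ₗ (A ∘ₗ h))
    (h' : Module.End R C₁) (hh' : h' = h + h ∘ₗ (A ∘ₗ h)) :
    p' ∘ₗ i' = LinearMap.id := by
  subst hi' hp'
  have hhi (x : C₂) : h (i x) = 0 := LinearMap.congr_fun hside₁ x
  have hph (x : C₁) : p (h x) = 0 := LinearMap.congr_fun hside₂ x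
  have hhh (x : C₁) : h (h x) = 0 := LinearMap.congr_fun hside₃ x
  have hpi_apply (x : C₂) : p (i x) = x := LinearMap.congr_fun hpi x
  ext x
  simp [hhi, hph, hhh, hpi_apply]
end

section
/- Let k be a commutative ring, R = k[x₁, …, x_N], W ∈ R, and let D be an n × n matrix over R with D * D = W • 1. If X is an n × n matrix over R with D*X = X*D (an even BRST cocycle), then (∂ⱼW) • X = D*Y + Y*D where Y = (∂ⱼD) * X; that is, multiplication by any partial derivative of W on even cocycles is null-homotopic with explicit homotopy (∂ⱼD) * X. -/
/-- The Leibniz rule for a derivation applied entrywise to a product of matrices. -/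
theorem Derivation.matrix_map_mul {k A l m n : Type*} [CommRing k] [CommRing A] [Algebra k A]
    [Fintype m] (d : Derivation k A A) (M : Matrix l m A) (P : Matrix m n A) :
    (M * P).map d = M * P.map d + M.map d * P := by
  ext a b
  simp only [Matrix.map_apply, Matrix.mul_apply, Matrix.add_apply, map_sum, Derivation.leibniz,
    smul_eq_mul, Finset.sum_add_distrib]
  simp only [mul_comm (P _ _)]

/-- The entrywise derivative of a scalar matrix is the scalar matrix of the derivative. -/
theorem Derivation.matrix_map_smul_one {k A n : Type*} [CommRing k] [CommRing A] [Algebra k A]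
    [DecidableEq n] (d : Derivation k A A) (a : A) :
    (a • (1 : Matrix n n A)).map d = d a • 1 := by
  ext i j
  by_cases h : i = j <;> simp [h]

/-- For a matrix factorization `D * D = W • 1` and an even BRST cocycle `X`
(i.e. `D*X = X*D`), multiplication by `∂ⱼW` is null-homotopic with explicit
homotopy `Y = (∂ⱼD) * X`:  `(∂ⱼW) • X = D*Y + Y*D`. -/
theorem pderivW_nullhomotopic_on_even_cocycles
    {k : Type*} [CommRing k] {N n : ℕ}
    (W : MvPolynomial (Fin N) k)
    (D X : Matrix (Fin n) (Fin n) (MvPolynomial (Fin N) k))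
    (hD : D * D = W • 1) (hX : D * X = X * D) (j : Fin N) :
    (MvPolynomial.pderiv j W) • X =
      D * (D.map (⇑(MvPolynomial.pderiv j)) * X) +
        (D.map (⇑(MvPolynomial.pderiv j)) * X) * D := by
  have h := congrArg (fun M => M.map (MvPolynomial.pderiv j)) hD
  simp only [Derivation.matrix_map_mul, Derivation.matrix_map_smul_one] at h
  rw [Matrix.mul_assoc _ X D, ← hX, ← Matrix.mul_assoc, ← Matrix.mul_assoc, ← Matrix.add_mul, h,
    Matrix.smul_mul, Matrix.one_mul]
end

section
/- Let k be a commutative ring, R = k[x₁, …, x_N], W ∈ R, and let D be an n × n matrix over R with D * D = W • 1. If X is an n × n matrix over R with D*X + X*D = 0 (an odd BRST cocycle), then (∂ⱼW) • X = D*Y − Y*D where Y = (∂ⱼD) * X; that is, multiplication by any partial derivative of W on odd cocycles is null-homotopic. -/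
/-- The Leibniz rule for a derivation applied entrywise to a product of matrices. -/
theorem Matrix.map_derivation_mul {k R l m n : Type*} [CommSemiring k] [CommSemiring R]
    [Algebra k R] [Fintype m] (d : Derivation k R R) (A : Matrix l m R) (B : Matrix m n R) :
    (A * B).map d = A * B.map d + A.map d * B := by
  ext a b
  simp only [Matrix.map_apply, Matrix.add_apply, Matrix.mul_apply, map_sum, Derivation.leibniz,
    smul_eq_mul, Finset.sum_add_distrib]
  congr 1
  exact Finset.sum_congr rfl fun _ _ => mul_comm _ _

/-- A derivation applied entrywise to a scalar matrix. -/
theorem Matrix.map_derivation_smul_one {k R n : Type*} [CommSemiring k] [CommSemiring R]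
    [Algebra k R] [DecidableEq n] (d : Derivation k R R) (r : R) :
    (r • (1 : Matrix n n R)).map d = d r • (1 : Matrix n n R) := by
  ext a b
  by_cases h : a = b <;> simp [h]

/-- For a matrix factorization `D * D = W • 1` and an odd BRST cocycle `X`
(i.e. `D*X + X*D = 0`), multiplication by `∂ⱼW` is null-homotopic with
explicit homotopy `Y = (∂ⱼD) * X`:  `(∂ⱼW) • X = D*Y − Y*D`. -/
theorem pderivW_nullhomotopic_on_odd_cocycles
    {k : Type*} [CommRing k] {N n : ℕ}
    (W : MvPolynomial (Fin N) k)
    (D X : Matrix (Fin n) (Fin n) (MvPolynomial (Fin N) k))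
    (hD : D * D = W • 1) (hX : D * X + X * D = 0) (j : Fin N) :
    (MvPolynomial.pderiv j W) • X =
      D * (D.map (⇑(MvPolynomial.pderiv j)) * X) -
        (D.map (⇑(MvPolynomial.pderiv j)) * X) * D := by
  have hW := congrArg (fun M => M.map (MvPolynomial.pderiv j)) hD
  simp only [Matrix.map_derivation_mul, Matrix.map_derivation_smul_one] at hW
  have hXD : X * D = -(D * X) := eq_neg_of_add_eq_zero_right hX
  calc (MvPolynomial.pderiv j W) • X
      = ((MvPolynomial.pderiv j W) • (1 : Matrix (Fin n) (Fin n) _)) * X := by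
        rw [Matrix.smul_mul, Matrix.one_mul]
    _ = _ := by
        rw [← hW, Matrix.mul_assoc (D.map _) X D, hXD]
        noncomm_ring
end

section
/- Let R be a commutative ring in which 2 is invertible, W ∈ R, and let D be an n × n matrix over R with D * D = W • 1. If X is an n × n matrix over R with D*X + X*D = 0, then W • X = D*Y − Y*D where Y = (1/2) • (D*X); that is, multiplication by the potential W on odd BRST cocycles is null-homotopic. -/
/-- If `2` is invertible, then for a matrix factorization `D * D = W • 1`
and an odd BRST cocycle `X` (`D*X + X*D = 0`), multiplication by the
potential `W` is null-homotopic with homotopy `Y = (1/2) • (D*X)`: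
`W • X = D*Y − Y*D`. -/
theorem W_nullhomotopic_on_odd_cocycles
    {R : Type*} [CommRing R] [Invertible (2 : R)] {n : ℕ}
    (W : R) (D X : Matrix (Fin n) (Fin n) R)
    (hD : D * D = W • 1) (hX : D * X + X * D = 0) :
    W • X = D * ((⅟2 : R) • (D * X)) - ((⅟2 : R) • (D * X)) * D := by
  have hXD : X * D = -(D * X) := eq_neg_of_add_eq_zero_right hX
  have hDDX : D * (D * X) = W • X := by
    rw [← mul_assoc, hD, smul_mul_assoc, one_mul]
  have hDXD : D * X * D = -(W • X) := by
    rw [mul_assoc, hXD, mul_neg, hDDX]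
  rw [mul_smul_comm, smul_mul_assoc, hDDX, hDXD, smul_neg, sub_neg_eq_add, ← add_smul,
    invOf_two_add_invOf_two, one_smul]
end
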